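/- arXiv:2509.23002 — 2 statements merged into one kernel-verified Lean document; each statement's English description precedes it below -/
import Mathlib

section
/- (B-UCP alignment guarantee) Let J ≥ 1 and α ∈ (0,1). For j = 1, …, J+1 let P_j : Ω × [0,1] → ℝ be random predicates such that for every ω the map τ ↦ P_j(ω, τ) is nondecreasing, right-continuous, takes values in {0, 1}, and satisfies P_j(ω, 1) = 1. Define the minimal passing strictness S_j(ω) := sInf{τ ∈ [0,1] : P_j(ω, τ) = 1}, and assume S_1, …, S_{J+1} are measurable and exchangeable. Set K := ⌈(1−α)(J+1)⌉, assume K ≤ J, and let τ̂ be the K-th order statistic of (S_1, …, S_J). Then P(P_{J+1}(τ̂) = 1) ≥ 1 − α. -/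
open MeasureTheory

/-- The `k`-th order statistic (k-th smallest, `k` 1-indexed) of a finite multiset of reals. -/
noncomputable def orderStat (s : Multiset ℝ) (k : ℕ) : ℝ :=
  (s.sort (· ≤ ·)).getD (k - 1) 0

theorem orderStat_mem {s : Multiset ℝ} {k : ℕ} (h1 : 1 ≤ k) (hk : k ≤ s.card) :
    orderStat s k ∈ s := by
  have hl : k - 1 < (s.sort (· ≤ ·)).length := by
    rw [Multiset.length_sort]; omega
  rw [orderStat, List.getD_eq_getElem _ _ hl]
  exact (Multiset.mem_sort (r := (· ≤ ·))).1 (List.getElem_mem hl)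

/-- At least `k` elements of `s` are bounded above by its `k`-th order statistic. -/
theorem le_countP_le_orderStat {s : Multiset ℝ} {k : ℕ} (h1 : 1 ≤ k) (hk : k ≤ s.card) :
    k ≤ s.countP (· ≤ orderStat s k) := by
  have hl : k - 1 < (s.sort (· ≤ ·)).length := by
    rw [Multiset.length_sort]; omega
  have hcount : s.countP (· ≤ orderStat s k)
      = (s.sort (· ≤ ·)).countP (· ≤ orderStat s k) := by
    conv_lhs => rw [← Multiset.sort_eq s (· ≤ ·)]
    rw [Multiset.coe_countP, Multiset.sort_eq]
  have hsorted : (s.sort (· ≤ ·)).Pairwise (· ≤ ·) := Multiset.pairwise_sort s (· ≤ ·)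
  have htake : ((s.sort (· ≤ ·)).take k).countP (· ≤ orderStat s k) = k := by
    have hlen : ((s.sort (· ≤ ·)).take k).length = k := by
      rw [List.length_take]; omega
    conv_rhs => rw [← hlen]
    rw [List.countP_eq_length]
    intro a ha
    obtain ⟨i, hi, rfl⟩ := List.mem_iff_getElem.1 ha
    rw [hlen] at hi
    rw [decide_eq_true_eq, List.getElem_take, orderStat, List.getD_eq_getElem _ _ hl]
    exact hsorted.sortedLE.getElem_le_getElem_of_le (by omega)
  rw [hcount]
  exact htake.symm.le.trans ((List.take_sublist _ _).countP_le)

/-- At least `k` entries of a real tuple of length at least `k` have fewer than `k` entries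
strictly below them. -/
theorem le_card_filter_card_lt {n : ℕ} (s : Fin n → ℝ) {k : ℕ} (hk : k ≤ n) :
    k ≤ (Finset.univ.filter fun i =>
      (Finset.univ.filter fun j => s j < s i).card < k).card := by
  have hmono := Tuple.monotone_sort s
  set σ := Tuple.sort s
  have hinj : Function.Injective fun l : Fin k => σ (Fin.castLE hk l) :=
    σ.injective.comp (Fin.castLE_injective hk)
  have hcard : (Finset.univ.image fun l : Fin k => σ (Fin.castLE hk l)).card = k := by
    rw [Finset.card_image_of_injective _ hinj, Finset.card_univ, Fintype.card_fin]
  conv_lhs => rw [← hcard]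
  refine Finset.card_le_card fun i hi => ?_
  obtain ⟨l, -, rfl⟩ := Finset.mem_image.1 hi
  rw [Finset.mem_filter]
  refine ⟨Finset.mem_univ _, ?_⟩
  have hsub : (Finset.univ.filter fun j => s j < s (σ (Fin.castLE hk l)))
      ⊆ (Finset.Iio (Fin.castLE hk l)).map σ.toEmbedding := by
    intro j hj
    rw [Finset.mem_filter] at hj
    refine Finset.mem_map.2 ⟨σ.symm j, ?_, σ.apply_symm_apply j⟩
    rw [Finset.mem_Iio]
    by_contra hle
    have := hmono (not_lt.1 hle)
    simp only [Function.comp_apply, Equiv.apply_symm_apply] at this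
    exact absurd hj.2 (not_lt.2 this)
  have := Finset.card_le_card hsub
  rw [Finset.card_map, Fin.card_Iio] at this
  exact this.trans_lt l.2

theorem measurableSet_card_lt {n : ℕ} (i : Fin n) (k : ℕ) :
    MeasurableSet {s : Fin n → ℝ | (Finset.univ.filter fun j => s j < s i).card < k} := by
  simp only [Finset.card_filter]
  refine measurableSet_lt (Finset.measurable_sum _ fun j _ => ?_) measurable_const
  exact Measurable.ite (measurableSet_lt (measurable_pi_apply j) (measurable_pi_apply i))
    measurable_const measurable_const

/-- For an exchangeable real tuple of length `n`, each entry has fewer than `k ≤ n` entries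
strictly below it with probability at least `k / n`. -/
theorem le_mul_measure_card_lt {Ω : Type*} [MeasurableSpace Ω] (P : Measure Ω)
    [IsProbabilityMeasure P] {n : ℕ} (S : Fin n → Ω → ℝ) (hSmeas : ∀ j, Measurable (S j))
    (hSexch : ∀ σ : Equiv.Perm (Fin n),
      Measure.map (fun ω (j : Fin n) => S (σ j) ω) P = Measure.map (fun ω (j : Fin n) => S j ω) P)
    {k : ℕ} (hk : k ≤ n) (i₀ : Fin n) :
    (k : ENNReal) ≤
      n * P {ω | (Finset.univ.filter fun j => S j ω < S i₀ ω).card < k} := by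
  let A : Fin n → Set Ω := fun i => {ω | (Finset.univ.filter fun j => S j ω < S i ω).card < k}
  have hmeas : ∀ i, MeasurableSet (A i) := fun i =>
    (measurable_pi_lambda (fun ω j => S j ω) hSmeas) (measurableSet_card_lt i k)
  have heq : ∀ i, P (A i) = P (A i₀) := by
    intro i
    have h := congrArg
      (fun μ => μ {s : Fin n → ℝ | (Finset.univ.filter fun j => s j < s i₀).card < k})
      (hSexch (Equiv.swap i i₀))
    rw [Measure.map_apply (measurable_pi_lambda _ fun j => hSmeas _) (measurableSet_card_lt i₀ k),
      Measure.map_apply (measurable_pi_lambda _ hSmeas) (measurableSet_card_lt i₀ k)] at h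
    refine Eq.trans (congrArg P ?_) h
    ext ω
    have hcard : (Finset.univ.filter fun j => S (Equiv.swap i i₀ j) ω < S i ω).card
        = (Finset.univ.filter fun j => S j ω < S i ω).card :=
      Finset.card_equiv (Equiv.swap i i₀) (by simp)
    simp only [A, Set.mem_ofPred_eq, Set.mem_preimage, Equiv.swap_apply_right, hcard]
  calc (k : ENNReal) = ∫⁻ _, (k : ENNReal) ∂P := by simp
    _ ≤ ∫⁻ ω, ∑ i, (A i).indicator 1 ω ∂P := by
        refine lintegral_mono fun ω => ?_
        have h := le_card_filter_card_lt (fun j => S j ω) hk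
        rw [Finset.card_filter] at h
        have h' : (k : ENNReal) ≤ ((∑ i : Fin n,
            if (Finset.univ.filter fun j => S j ω < S i ω).card < k then 1 else 0 : ℕ) :
              ENNReal) := by exact_mod_cast h
        simpa [A, Set.indicator_apply] using h'
    _ = ∑ i, P (A i) := by
        rw [lintegral_finsetSum _ fun i _ => measurable_one.indicator (hmeas i)]
        simp [lintegral_indicator_one (hmeas _)]
    _ = n * P (A i₀) := by simp [heq]

/-- A right-continuous `{0,1}`-valued predicate on `[0,1]` that passes at `1` passes at its minimal
passing strictness and at every larger threshold. -/
theorem eq_one_of_sInf_le {f : ℝ → ℝ} (hmono : MonotoneOn f (Set.Icc 0 1))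
    (hrc : ∀ τ ∈ Set.Ico (0 : ℝ) 1,
      Filter.Tendsto f (nhdsWithin τ (Set.Ioc τ 1)) (nhds (f τ)))
    (hvals : ∀ τ ∈ Set.Icc (0 : ℝ) 1, f τ = 0 ∨ f τ = 1) (hone : f 1 = 1)
    {t : ℝ} (ht : t ≤ 1) (hle : sInf {τ ∈ Set.Icc (0 : ℝ) 1 | f τ = 1} ≤ t) : f t = 1 := by
  set E := {τ ∈ Set.Icc (0 : ℝ) 1 | f τ = 1}
  have hne : E.Nonempty := ⟨1, by simp [E, hone]⟩
  have h0 : 0 ≤ sInf E := le_csInf hne fun τ hτ => hτ.1.1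
  have hgt : ∀ u ∈ Set.Ioc (sInf E) 1, f u = 1 := by
    intro u hu
    obtain ⟨τ, hτ, hlt⟩ := exists_lt_of_csInf_lt hne hu.1
    have huI : u ∈ Set.Icc (0 : ℝ) 1 := ⟨h0.trans hu.1.le, hu.2⟩
    have := hmono hτ.1 huI hlt.le
    rw [hτ.2] at this
    rcases hvals u huI with h | h
    · linarith
    · exact h
  rcases hle.lt_or_eq with hlt | rfl
  · exact hgt t ⟨hlt, ht⟩
  rcases ht.lt_or_eq with hlt | heq
  · have hT := hrc _ ⟨h0, hlt⟩
    have : (nhdsWithin (sInf E) (Set.Ioc (sInf E) 1)).NeBot := by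
      rw [nhdsWithin_Ioc_eq_nhdsGT hlt]; infer_instance
    refine tendsto_nhds_unique hT (tendsto_const_nhds.congr' ?_)
    filter_upwards [self_mem_nhdsWithin] with u hu using (hgt u hu).symm
  · rw [heq, hone]

/-- B-UCP alignment guarantee: For random predicates `P j (ω, ·)` on `[0,1]`
that are nondecreasing, right-continuous, `{0,1}`-valued and equal to `1` at `τ = 1`, with
minimal passing strictness `S j = sInf {τ ∈ [0,1] : P j τ = 1}` measurable and exchangeable,
`K = ⌈(1-α)(J+1)⌉ ≤ J`, and `τ̂` the `K`-th order statistic of `(S 1, …, S J)`, we have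
`P(P (J+1) (τ̂) = 1) ≥ 1 - α`. -/
theorem bucp_alignment_guarantee
    {Ω : Type*} [MeasurableSpace Ω] (P : Measure Ω) [IsProbabilityMeasure P]
    (J : ℕ) (hJ : 1 ≤ J) (α : ℝ) (hα : α ∈ Set.Ioo (0 : ℝ) 1)
    (Pred : Fin (J + 1) → Ω → ℝ → ℝ)
    (hmono : ∀ j ω, MonotoneOn (Pred j ω) (Set.Icc 0 1))
    (hrc : ∀ j ω, ∀ τ ∈ Set.Ico (0 : ℝ) 1,
      Filter.Tendsto (Pred j ω) (nhdsWithin τ (Set.Ioc τ 1)) (nhds (Pred j ω τ)))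
    (hvals : ∀ j ω, ∀ τ ∈ Set.Icc (0 : ℝ) 1, Pred j ω τ = 0 ∨ Pred j ω τ = 1)
    (hone : ∀ j ω, Pred j ω 1 = 1)
    (S : Fin (J + 1) → Ω → ℝ)
    (hS : ∀ j ω, S j ω = sInf {τ ∈ Set.Icc (0 : ℝ) 1 | Pred j ω τ = 1})
    (hSmeas : ∀ j, Measurable (S j))
    (hSexch : ∀ σ : Equiv.Perm (Fin (J + 1)),
      Measure.map (fun ω (j : Fin (J + 1)) => S (σ j) ω) P
        = Measure.map (fun ω (j : Fin (J + 1)) => S j ω) P)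
    (hK : ⌈(1 - α) * ((J : ℝ) + 1)⌉₊ ≤ J) :
    ENNReal.ofReal (1 - α) ≤
      P {ω | Pred (Fin.last J) ω
        (orderStat ((Finset.univ : Finset (Fin J)).val.map fun j => S j.castSucc ω)
          ⌈(1 - α) * ((J : ℝ) + 1)⌉₊) = 1} := by
  set K := ⌈(1 - α) * ((J : ℝ) + 1)⌉₊
  have hpos : 0 < (1 - α) * ((J : ℝ) + 1) := mul_pos (by linarith [hα.2]) (by positivity)
  have hK1 : 1 ≤ K := Nat.ceil_pos.2 hpos
  have hmain := le_mul_measure_card_lt P S hSmeas hSexch (hK.trans J.le_succ) (Fin.last J)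
  have hsub : {ω | (Finset.univ.filter fun j => S j ω < S (Fin.last J) ω).card < K} ⊆
      {ω | Pred (Fin.last J) ω
        (orderStat ((Finset.univ : Finset (Fin J)).val.map fun j => S j.castSucc ω) K) = 1} := by
    intro ω hω
    have hcard : K ≤ ((Finset.univ : Finset (Fin J)).val.map fun j => S j.castSucc ω).card := by
      simpa using hK
    have hmem := orderStat_mem hK1 hcard
    have hcount := le_countP_le_orderStat hK1 hcard
    simp only [Set.mem_ofPred_eq] at hω ⊢
    set t := orderStat ((Finset.univ : Finset (Fin J)).val.map fun j => S j.castSucc ω) K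
    refine eq_one_of_sInf_le (hmono _ ω) (hrc _ ω) (hvals _ ω) (hone _ ω) ?_ ?_
    · obtain ⟨j, -, hj⟩ := Multiset.mem_map.1 hmem
      rw [← hj, hS]
      exact csInf_le ⟨0, fun τ hτ => hτ.1.1⟩ ⟨by simp, hone _ ω⟩
    · rw [← hS]
      by_contra! hlt
      rw [Multiset.countP_map] at hcount
      have hle : ((Finset.univ.filter fun j : Fin J => S j.castSucc ω ≤ t).map
          Fin.castSuccEmb).card
          ≤ (Finset.univ.filter fun j => S j ω < S (Fin.last J) ω).card := by
        refine Finset.card_le_card fun i hi => ?_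
        obtain ⟨j, hj, rfl⟩ := Finset.mem_map.1 hi
        exact Finset.mem_filter.2 ⟨Finset.mem_univ _, (Finset.mem_filter.1 hj).2.trans_lt hlt⟩
      rw [Finset.card_map] at hle
      exact absurd (hcount.trans hle) (not_le.2 hω)
  refine le_trans ?_ (measure_mono hsub)
  have hceil : ENNReal.ofReal (1 - α) * ((J + 1 : ℕ) : ENNReal) ≤ K := by
    rw [← ENNReal.ofReal_natCast (J + 1), ← ENNReal.ofReal_natCast K,
      ← ENNReal.ofReal_mul (by linarith [hα.2])]
    exact ENNReal.ofReal_le_ofReal (by simpa using Nat.le_ceil ((1 - α) * ((J : ℝ) + 1)))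
  have hfin := hceil.trans hmain
  rw [mul_comm] at hfin
  exact (ENNReal.mul_le_mul_iff_right (by simp) (ENNReal.natCast_ne_top _)).1 hfin
end

section
/- Let J ≥ 1, α ∈ (0,1), and let S_1, …, S_{J+1} be exchangeable random variables on a probability space taking values in [0,1]. Set K := ⌈(1−α)(J+1)⌉, assume K ≤ J, and let τ̂ be the K-th order statistic of (S_1, …, S_J). Then P(S_{J+1} ≤ τ̂) ≥ 1 − α. -/
open MeasureTheory

/-- The number of coordinates of `x` that are strictly below the `i`-th one. -/
noncomputable def strictRank {n : ℕ} (x : Fin n → ℝ) (i : Fin n) : ℕ :=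
  ∑ j, Set.indicator {y : Fin n → ℝ | y j < y i} (fun _ => 1) x

open Classical in
theorem strictRank_eq_card {n : ℕ} (x : Fin n → ℝ) (i : Fin n) :
    strictRank x i = (Finset.univ.filter fun j => x j < x i).card := by
  rw [strictRank, Finset.card_filter]
  simp only [Set.indicator_apply, Set.mem_ofPred_eq]

theorem strictRank_comp_perm {n : ℕ} (x : Fin n → ℝ) (σ : Equiv.Perm (Fin n)) (i : Fin n) :
    strictRank (fun j => x (σ j)) i = strictRank x (σ i) := by
  simp only [strictRank, Set.indicator_apply, Set.mem_ofPred_eq]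
  exact Equiv.sum_comp σ fun j => if x j < x (σ i) then 1 else 0

theorem measurable_strictRank {n : ℕ} (i : Fin n) :
    Measurable fun x : Fin n → ℝ => strictRank x i := by
  unfold strictRank
  exact Finset.measurable_sum _ fun j _ => measurable_const.indicator
    (measurableSet_lt (measurable_pi_apply j) (measurable_pi_apply i))

open Classical in
theorem le_card_strictRank_lt {n : ℕ} (x : Fin n → ℝ) {k : ℕ} (hk : k ≤ n) :
    k ≤ (Finset.univ.filter fun i => strictRank x i < k).card := by
  have hmono := Tuple.monotone_sort x
  have hrank (i : Fin n) : strictRank x (Tuple.sort x i) ≤ i := by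
    rw [← strictRank_comp_perm, strictRank_eq_card, ← Fin.card_Iio i]
    refine Finset.card_le_card fun j hj => ?_
    simp only [Finset.mem_filter, Finset.mem_univ, true_and] at hj
    exact Finset.mem_Iio.2 (hmono.reflect_lt hj)
  calc k = (Finset.univ : Finset (Fin k)).card := by simp
    _ ≤ _ := Finset.card_le_card_of_injOn (fun i => Tuple.sort x (Fin.castLE hk i))
      (fun i _ => by simpa using (hrank (Fin.castLE hk i)).trans_lt i.2)
      (fun i _ j _ h => by simpa using h)

open Classical in
theorem le_orderStat_of_countP_lt {s : Multiset ℝ} {k : ℕ} {x : ℝ}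
    (hks : k ≤ s.card) (h : s.countP (· < x) < k) : x ≤ orderStat s k := by
  have hlen : (s.sort (· ≤ ·)).length = s.card := Multiset.length_sort _
  have hlt : k - 1 < (s.sort (· ≤ ·)).length := by omega
  rw [orderStat, List.getD_eq_getElem _ _ hlt]
  by_contra! hx
  have hsorted : (s.sort (· ≤ ·)).Pairwise (· ≤ ·) := Multiset.pairwise_sort _ _
  have hcount : s.countP (· < x) = (s.sort (· ≤ ·)).countP (· < x) := by
    conv_lhs => rw [← Multiset.sort_eq s (· ≤ ·)]
    rw [Multiset.coe_countP]
  have htake : ((s.sort (· ≤ ·)).take k).countP (· < x) = ((s.sort (· ≤ ·)).take k).length := by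
    rw [List.countP_eq_length]
    intro a ha
    obtain ⟨i, hi, rfl⟩ := List.mem_iff_getElem.1 ha
    rw [List.length_take] at hi
    rw [List.getElem_take]
    exact decide_eq_true ((hsorted.rel_get_of_le (a := ⟨i, by omega⟩) (b := ⟨k - 1, hlt⟩)
      (Fin.mk_le_mk.2 (by omega))).trans_lt hx)
  have hle := (List.take_sublist k (s.sort (· ≤ ·))).countP_le (p := fun a => decide (a < x))
  rw [htake, List.length_take] at hle
  omega

theorem le_orderStat_of_strictRank_last_lt {J k : ℕ} (x : Fin (J + 1) → ℝ) (hk : k ≤ J)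
    (h : strictRank x (Fin.last J) < k) :
    x (Fin.last J) ≤
      orderStat ((Finset.univ : Finset (Fin J)).val.map fun j => x j.castSucc) k := by
  classical
  refine le_orderStat_of_countP_lt (by simpa using hk) (lt_of_eq_of_lt ?_ h)
  rw [Multiset.countP_map]
  simp only [strictRank, Set.indicator_apply, Set.mem_ofPred_eq, Fin.sum_univ_castSucc, lt_irrefl,
    if_false, add_zero]
  rw [← Finset.card_filter]
  rfl

theorem le_card_mul_measure_strictRank_lt {Ω : Type*} [MeasurableSpace Ω] (P : Measure Ω)
    [IsProbabilityMeasure P] {n : ℕ} (S : Fin n → Ω → ℝ) (hS : ∀ j, Measurable (S j))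
    (hexch : ∀ σ : Equiv.Perm (Fin n),
      Measure.map (fun ω j => S (σ j) ω) P = Measure.map (fun ω j => S j ω) P)
    {k : ℕ} (hk : k ≤ n) (i : Fin n) :
    (k : ENNReal) ≤ n * P {ω | strictRank (fun j => S j ω) i < k} := by
  classical
  have hmeas (j : Fin n) : MeasurableSet {x : Fin n → ℝ | strictRank x j < k} :=
    measurableSet_lt (measurable_strictRank j) measurable_const
  have hSpi : Measurable fun ω j => S j ω := measurable_pi_lambda _ hS
  have hevent (j : Fin n) : MeasurableSet {ω | strictRank (fun l => S l ω) j < k} :=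
    hSpi (hmeas j)
  have heq (j : Fin n) : P {ω | strictRank (fun l => S l ω) j < k}
      = P {ω | strictRank (fun l => S l ω) i < k} := by
    have h := congrArg (fun ν => ν {x | strictRank x i < k}) (hexch (Equiv.swap i j))
    rw [Measure.map_apply (measurable_pi_lambda _ fun l => hS _) (hmeas i),
      Measure.map_apply hSpi (hmeas i)] at h
    rw [← Equiv.swap_apply_left i j]
    simp only [← strictRank_comp_perm]
    simpa only [Set.preimage_ofPred_eq] using h
  calc (k : ENNReal) = ∫⁻ _, k ∂P := by simp
    _ ≤ ∫⁻ ω, ∑ j, {ω | strictRank (fun l => S l ω) j < k}.indicator 1 ω ∂P := by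
      refine lintegral_mono fun ω => ?_
      simp only [Set.indicator_apply, Set.mem_ofPred_eq, Pi.one_apply, Finset.sum_boole]
      exact_mod_cast le_card_strictRank_lt (fun l => S l ω) hk
    _ = ∑ j, P {ω | strictRank (fun l => S l ω) j < k} := by
      rw [lintegral_finsetSum _ fun j _ => measurable_one.indicator (hevent j)]
      exact Finset.sum_congr rfl fun j _ => lintegral_indicator_one (hevent j)
    _ = _ := by simp [heq]

/-- For exchangeable `[0,1]`-valued random variables `S 1, …, S (J+1)`,
`K = ⌈(1-α)(J+1)⌉ ≤ J`, and `τ̂` the `K`-th order statistic of `(S 1, …, S J)`, we have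
`P(S (J+1) ≤ τ̂) ≥ 1 - α`. -/
theorem exchangeable_quantile_coverage
    {Ω : Type*} [MeasurableSpace Ω] (P : Measure Ω) [IsProbabilityMeasure P]
    (J : ℕ) (hJ : 1 ≤ J) (α : ℝ) (hα : α ∈ Set.Ioo (0 : ℝ) 1)
    (S : Fin (J + 1) → Ω → ℝ)
    (hSmeas : ∀ j, Measurable (S j))
    (hSrange : ∀ j ω, S j ω ∈ Set.Icc (0 : ℝ) 1)
    (hSexch : ∀ σ : Equiv.Perm (Fin (J + 1)),
      Measure.map (fun ω (j : Fin (J + 1)) => S (σ j) ω) P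
        = Measure.map (fun ω (j : Fin (J + 1)) => S j ω) P)
    (hK : ⌈(1 - α) * ((J : ℝ) + 1)⌉₊ ≤ J) :
    ENNReal.ofReal (1 - α) ≤
      P {ω | S (Fin.last J) ω ≤
        orderStat ((Finset.univ : Finset (Fin J)).val.map fun j => S j.castSucc ω)
          ⌈(1 - α) * ((J : ℝ) + 1)⌉₊} := by
  have hrank := le_card_mul_measure_strictRank_lt P S hSmeas hSexch
    (hK.trans J.le_succ) (Fin.last J)
  have hmono := measure_mono (μ := P) fun ω (h : strictRank (fun j => S j ω) (Fin.last J)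
    < ⌈(1 - α) * ((J : ℝ) + 1)⌉₊) => le_orderStat_of_strictRank_last_lt _ hK h
  refine le_trans ?_ hmono
  have hne : ((J + 1 : ℕ) : ENNReal) ≠ 0 := by simp
  refine (ENNReal.mul_le_mul_iff_right hne (ENNReal.natCast_ne_top _)).1 (le_trans ?_ hrank)
  rw [← ENNReal.ofReal_natCast, ← ENNReal.ofReal_natCast,
    ← ENNReal.ofReal_mul (Nat.cast_nonneg _)]
  refine ENNReal.ofReal_le_ofReal ?_
  push_cast
  rw [mul_comm]
  exact Nat.le_ceil _
end
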